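/- Let κ ∈ ℝ, let m₁, m₂, m₃ > 0, and let x_i, y_i : I → ℝ (i = 1,2,3) be twice differentiable functions on an open interval I such that along the motion 1 − κ(x_i² + y_i²) > 0, ρ_ij > 0, and 1 − κρ_ij²/4 > 0 for all i ≠ j, where ρ_ij² = (x_i − x_j)² + (y_i − y_j)² + κ(x_i² + y_i² − x_j² − y_j²)²/(√(1 − κ(x_i² + y_i²)) + √(1 − κ(x_j² + y_j²)))², and suppose that for each i, ẍ_i = ∑_{j≠i} m_j[x_j − (1 − κρ_ij²/2)x_i]/(ρ_ij³(1 − κρ_ij²/4)^{3/2}) − κ(ẋ_i² + ẏ_i² + κB_i)x_i and ÿ_i = ∑_{j≠i} m_j[y_j − (1 − κρ_ij²/2)y_i]/(ρ_ij³(1 − κρ_ij²/4)^{3/2}) − κ(ẋ_i² + ẏ_i² + κB_i)y_i, with B_i = (x_iẋ_i + y_iẏ_i)²/(1 − κ(x_i² + y_i²)). Then the energy t ↦ T_κ(t) − U_κ(t) is constant on I, where T_κ = (1/2)∑_{i=1}^{3} m_i(ẋ_i² + ẏ_i² + κB_i) and U_κ = ∑_{1≤i<j≤3} m_i m_j (1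 − κρ_ij²/2)/(ρ_ij(1 − κρ_ij²/4)^{1/2}). -/

import Mathlib

open Real

/-- The squared mutual distance `ρ_ij²` in the intrinsic coordinates on the surface
of curvature `κ`, between bodies at positions `(x₁,y₁)` and `(x₂,y₂)`. -/
noncomputable def rhoSq (κ x₁ y₁ x₂ y₂ : ℝ) : ℝ :=
  (x₁ - x₂) ^ 2 + (y₁ - y₂) ^ 2 +
    κ * (x₁ ^ 2 + y₁ ^ 2 - x₂ ^ 2 - y₂ ^ 2) ^ 2 /
      (Real.sqrt (1 - κ * (x₁ ^ 2 + y₁ ^ 2)) + Real.sqrt (1 - κ * (x₂ ^ 2 + y₂ ^ 2))) ^ 2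

/-- The term `B_i = (x_i ẋ_i + y_i ẏ_i)² / (1 - κ(x_i² + y_i²))`. -/
noncomputable def Bterm (κ x y xd yd : ℝ) : ℝ :=
  (x * xd + y * yd) ^ 2 / (1 - κ * (x ^ 2 + y ^ 2))

/-- The pairing of the velocity `(u, v)` of a body at `(x₁, y₁)` with the direction towards a body
at `(x₂, y₂)`, so that the squared distance decreases at twice this rate when only the first body
moves. -/
noncomputable def attractionPower (κ x₁ y₁ u v x₂ y₂ : ℝ) : ℝ :=
  x₂ * u + y₂ * v - (x₁ * u + y₁ * v) *
    (√(1 - κ * (x₂ ^ 2 + y₂ ^ 2)) / √(1 - κ * (x₁ ^ 2 + y₁ ^ 2)))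

theorem rhoSq_comm (κ x₁ y₁ x₂ y₂ : ℝ) : rhoSq κ x₁ y₁ x₂ y₂ = rhoSq κ x₂ y₂ x₁ y₁ := by
  unfold rhoSq
  rw [add_comm √(1 - κ * (x₁ ^ 2 + y₁ ^ 2))]
  ring

theorem one_sub_half_rhoSq {κ x₁ y₁ x₂ y₂ : ℝ} (h₁ : 0 < 1 - κ * (x₁ ^ 2 + y₁ ^ 2))
    (h₂ : 0 < 1 - κ * (x₂ ^ 2 + y₂ ^ 2)) :
    1 - κ * rhoSq κ x₁ y₁ x₂ y₂ / 2 = κ * (x₁ * x₂ + y₁ * y₂) +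
      √(1 - κ * (x₁ ^ 2 + y₁ ^ 2)) * √(1 - κ * (x₂ ^ 2 + y₂ ^ 2)) := by
  unfold rhoSq
  have hs₁ := Real.sq_sqrt h₁.le
  have hs₂ := Real.sq_sqrt h₂.le
  have hp₁ := Real.sqrt_pos.2 h₁
  have hp₂ := Real.sqrt_pos.2 h₂
  set s₁ := √(1 - κ * (x₁ ^ 2 + y₁ ^ 2))
  set s₂ := √(1 - κ * (x₂ ^ 2 + y₂ ^ 2))
  have hdiff : κ * (κ * (x₁ ^ 2 + y₁ ^ 2 - x₂ ^ 2 - y₂ ^ 2) ^ 2 / (s₁ + s₂) ^ 2)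
      = (s₁ - s₂) ^ 2 := by
    have hw : κ * (x₁ ^ 2 + y₁ ^ 2 - x₂ ^ 2 - y₂ ^ 2) = (s₂ - s₁) * (s₁ + s₂) := by
      linear_combination hs₁ - hs₂
    rw [← mul_div_assoc, ← mul_assoc, ← sq, ← mul_pow, hw]
    field_simp
    ring
  linear_combination (-1 / 2) * hdiff - (1 / 2) * hs₁ - (1 / 2) * hs₂

theorem hasDerivAt_sqrt_one_sub {κ t u v : ℝ} {x y : ℝ → ℝ} (hx : HasDerivAt x u t)
    (hy : HasDerivAt y v t) (h : 0 < 1 - κ * (x t ^ 2 + y t ^ 2)) :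
    HasDerivAt (fun τ => √(1 - κ * (x τ ^ 2 + y τ ^ 2)))
      (-κ * (x t * u + y t * v) / √(1 - κ * (x t ^ 2 + y t ^ 2))) t := by
  refine (((((hx.fun_pow 2).fun_add (hy.fun_pow 2)).const_mul κ).const_sub 1).sqrt
    h.ne').congr_deriv ?_
  field_simp
  ring

theorem hasDerivAt_rhoSq {κ t u₁ v₁ u₂ v₂ : ℝ} {x₁ y₁ x₂ y₂ : ℝ → ℝ}
    (hx₁ : HasDerivAt x₁ u₁ t) (hy₁ : HasDerivAt y₁ v₁ t)
    (hx₂ : HasDerivAt x₂ u₂ t) (hy₂ : HasDerivAt y₂ v₂ t)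
    (h₁ : 0 < 1 - κ * (x₁ t ^ 2 + y₁ t ^ 2)) (h₂ : 0 < 1 - κ * (x₂ t ^ 2 + y₂ t ^ 2)) :
    HasDerivAt (fun τ => rhoSq κ (x₁ τ) (y₁ τ) (x₂ τ) (y₂ τ))
      (-2 * (attractionPower κ (x₁ t) (y₁ t) u₁ v₁ (x₂ t) (y₂ t) +
        attractionPower κ (x₂ t) (y₂ t) u₂ v₂ (x₁ t) (y₁ t))) t := by
  have hd₁ := hasDerivAt_sqrt_one_sub hx₁ hy₁ h₁
  have hd₂ := hasDerivAt_sqrt_one_sub hx₂ hy₂ h₂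
  have hs₁ := Real.sq_sqrt h₁.le
  have hs₂ := Real.sq_sqrt h₂.le
  have hp₁ := Real.sqrt_pos.2 h₁
  have hp₂ := Real.sqrt_pos.2 h₂
  have hS : (√(1 - κ * (x₁ t ^ 2 + y₁ t ^ 2)) + √(1 - κ * (x₂ t ^ 2 + y₂ t ^ 2))) ^ 2 ≠ 0 := by
    positivity
  have key := (((hx₁.fun_sub hx₂).fun_pow 2).fun_add ((hy₁.fun_sub hy₂).fun_pow 2)).fun_add
    ((((((hx₁.fun_pow 2).fun_add (hy₁.fun_pow 2)).fun_sub (hx₂.fun_pow 2)).fun_sub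
      (hy₂.fun_pow 2)).fun_pow 2).const_mul κ |>.fun_div ((hd₁.fun_add hd₂).fun_pow 2) hS)
  unfold rhoSq attractionPower
  refine key.congr_deriv ?_
  set s₁ := √(1 - κ * (x₁ t ^ 2 + y₁ t ^ 2))
  set s₂ := √(1 - κ * (x₂ t ^ 2 + y₂ t ^ 2))
  have hw : κ * (x₁ t ^ 2 + y₁ t ^ 2 - x₂ t ^ 2 - y₂ t ^ 2) = (s₂ - s₁) * (s₁ + s₂) := by
    linear_combination hs₁ - hs₂
  set p₁ := x₁ t * u₁ + y₁ t * v₁ with hp₁_def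
  set p₂ := x₂ t * u₂ + y₂ t * v₂ with hp₂_def
  set w := x₁ t ^ 2 + y₁ t ^ 2 - x₂ t ^ 2 - y₂ t ^ 2
  have hquot : 2 * (κ * w) * (2 * p₁ - 2 * p₂) / (s₁ + s₂) ^ 2
      + 2 * (κ * w) ^ 2 * (p₁ / s₁ + p₂ / s₂) / (s₁ + s₂) ^ 3
      = 2 * (s₂ - s₁) * (p₁ / s₁ - p₂ / s₂) := by
    rw [hw]
    field_simp
    ring
  have hrest : (κ * (2 * w ^ 1 * (2 * p₁ - 2 * p₂)) * (s₁ + s₂) ^ 2 -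
        κ * w ^ 2 * (2 * (s₁ + s₂) ^ 1 * (-κ * p₁ / s₁ + -κ * p₂ / s₂))) / ((s₁ + s₂) ^ 2) ^ 2
      = 2 * (s₂ - s₁) * (p₁ / s₁ - p₂ / s₂) := by
    rw [← hquot]
    field_simp
    ring
  rw [hp₁_def, hp₂_def] at hrest ⊢
  simp only [Nat.cast_ofNat, Nat.add_one_sub_one]
  trans 2 * (x₁ t - x₂ t) * (u₁ - u₂) + 2 * (y₁ t - y₂ t) * (v₁ - v₂) +
    2 * (s₂ - s₁) * (p₁ / s₁ - p₂ / s₂)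
  · rw [← hrest]; ring
  · rw [hp₁_def, hp₂_def]
    field_simp
    ring

/-- The derivative of the pair force function with respect to the squared distance. -/
theorem hasDerivAt_pairPotential {κ R : ℝ} (hR : 0 < R) (hκ : 0 < 1 - κ * R / 4) :
    HasDerivAt (fun r => (1 - κ * r / 2) / (√r * (1 - κ * r / 4) ^ ((1 : ℝ) / 2)))
      (-(1 / 2) / (√R ^ 3 * (1 - κ * R / 4) ^ ((3 : ℝ) / 2))) R := by
  have hpow : (1 - κ * R / 4) ^ ((3 : ℝ) / 2) = √(1 - κ * R / 4) ^ 3 := by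
    rw [Real.sqrt_eq_rpow, ← Real.rpow_mul_natCast hκ.le]
    norm_num
  simp_rw [← Real.sqrt_eq_rpow]
  rw [hpow]
  have ha := Real.sq_sqrt hR.le
  have hb := Real.sq_sqrt hκ.le
  have hpa := Real.sqrt_pos.2 hR
  have hpb := Real.sqrt_pos.2 hκ
  have hid := hasDerivAt_id' R
  have key := (((hid.const_mul κ).div_const 2).const_sub 1).fun_div
    ((hid.sqrt hR.ne').fun_mul ((((hid.const_mul κ).div_const 4).const_sub 1).sqrt hκ.ne'))
    (mul_pos hpa hpb).ne'
  refine key.congr_deriv ?_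
  set p := √R
  set q := √(1 - κ * R / 4)
  have hc : 1 - κ * R / 2 = 2 * q ^ 2 - 1 := by rw [hb]; ring
  have hk : κ * p ^ 2 = 4 * (1 - q ^ 2) := by rw [ha, hb]; ring
  have hκ' : κ = 4 * (1 - q ^ 2) / p ^ 2 := by rw [← hk]; field_simp
  rw [hc, hκ']
  field_simp
  ring

/-- The constraint term of the equations of motion does no work. -/
theorem hasDerivAt_kinetic {κ t f g u' v' : ℝ} {x y u v : ℝ → ℝ}
    (hx : HasDerivAt x (u t) t) (hy : HasDerivAt y (v t) t)
    (hu : HasDerivAt u u' t) (hv : HasDerivAt v v' t)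
    (h : 0 < 1 - κ * (x t ^ 2 + y t ^ 2))
    (hu' : u' = f - κ * (u t ^ 2 + v t ^ 2 + κ * Bterm κ (x t) (y t) (u t) (v t)) * x t)
    (hv' : v' = g - κ * (u t ^ 2 + v t ^ 2 + κ * Bterm κ (x t) (y t) (u t) (v t)) * y t) :
    HasDerivAt (fun τ => u τ ^ 2 + v τ ^ 2 + κ * Bterm κ (x τ) (y τ) (u τ) (v τ))
      (2 * (f * u t + g * v t + κ * (x t * u t + y t * v t) * (f * x t + g * y t) /
        (1 - κ * (x t ^ 2 + y t ^ 2)))) t := by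
  unfold Bterm at *
  have key := ((hu.fun_pow 2).fun_add (hv.fun_pow 2)).fun_add
    (((((hx.fun_mul hu).fun_add (hy.fun_mul hv)).fun_pow 2).fun_div
      ((((hx.fun_pow 2).fun_add (hy.fun_pow 2)).const_mul κ).const_sub 1) h.ne').const_mul κ)
  refine key.congr_deriv ?_
  rw [hu', hv']
  have hne := h.ne'
  field_simp
  ring

theorem attraction_work {κ x₁ y₁ u v x₂ y₂ : ℝ} (h₁ : 0 < 1 - κ * (x₁ ^ 2 + y₁ ^ 2))
    (h₂ : 0 < 1 - κ * (x₂ ^ 2 + y₂ ^ 2)) :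
    (x₂ - (1 - κ * rhoSq κ x₁ y₁ x₂ y₂ / 2) * x₁) * u +
      (y₂ - (1 - κ * rhoSq κ x₁ y₁ x₂ y₂ / 2) * y₁) * v +
      κ * (x₁ * u + y₁ * v) * ((x₂ - (1 - κ * rhoSq κ x₁ y₁ x₂ y₂ / 2) * x₁) * x₁ +
        (y₂ - (1 - κ * rhoSq κ x₁ y₁ x₂ y₂ / 2) * y₁) * y₁) / (1 - κ * (x₁ ^ 2 + y₁ ^ 2)) =
    attractionPower κ x₁ y₁ u v x₂ y₂ := by
  rw [one_sub_half_rhoSq h₁ h₂]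
  unfold attractionPower
  have hs₁ := Real.sq_sqrt h₁.le
  have hp₁ := Real.sqrt_pos.2 h₁
  set s₁ := √(1 - κ * (x₁ ^ 2 + y₁ ^ 2))
  set s₂ := √(1 - κ * (x₂ ^ 2 + y₂ ^ 2))
  rw [← hs₁]
  field_simp
  linear_combination (-(x₁ * u + y₁ * v) * (κ * (x₁ * x₂ + y₁ * y₂) + s₁ * s₂)) * hs₁

/-- Conservation of energy for system (31) of the paper: along any solution of the
curved 3-body problem in intrinsic coordinates the quantity `T_κ - U_κ` is constant. -/
theorem energy_conservation (κ : ℝ) (m : Fin 3 → ℝ) (hm : ∀ i, 0 < m i)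
    (a b : ℝ) (x y : Fin 3 → ℝ → ℝ)
    (hx : ∀ i, ∀ t ∈ Set.Ioo a b,
      DifferentiableAt ℝ (x i) t ∧ DifferentiableAt ℝ (deriv (x i)) t)
    (hy : ∀ i, ∀ t ∈ Set.Ioo a b,
      DifferentiableAt ℝ (y i) t ∧ DifferentiableAt ℝ (deriv (y i)) t)
    (hconstr : ∀ i, ∀ t ∈ Set.Ioo a b, 0 < 1 - κ * ((x i t) ^ 2 + (y i t) ^ 2))
    (hρpos : ∀ i j, i ≠ j → ∀ t ∈ Set.Ioo a b,
      0 < rhoSq κ (x i t) (y i t) (x j t) (y j t) ∧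
      0 < 1 - κ * rhoSq κ (x i t) (y i t) (x j t) (y j t) / 4)
    (heqx : ∀ i, ∀ t ∈ Set.Ioo a b,
      deriv (deriv (x i)) t
        = (∑ j ∈ Finset.univ.erase i,
            m j * (x j t - (1 - κ * rhoSq κ (x i t) (y i t) (x j t) (y j t) / 2) * x i t)
              / (Real.sqrt (rhoSq κ (x i t) (y i t) (x j t) (y j t)) ^ 3
                * (1 - κ * rhoSq κ (x i t) (y i t) (x j t) (y j t) / 4) ^ ((3 : ℝ) / 2)))
          - κ * ((deriv (x i) t) ^ 2 + (deriv (y i) t) ^ 2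
              + κ * Bterm κ (x i t) (y i t) (deriv (x i) t) (deriv (y i) t)) * x i t)
    (heqy : ∀ i, ∀ t ∈ Set.Ioo a b,
      deriv (deriv (y i)) t
        = (∑ j ∈ Finset.univ.erase i,
            m j * (y j t - (1 - κ * rhoSq κ (x i t) (y i t) (x j t) (y j t) / 2) * y i t)
              / (Real.sqrt (rhoSq κ (x i t) (y i t) (x j t) (y j t)) ^ 3
                * (1 - κ * rhoSq κ (x i t) (y i t) (x j t) (y j t) / 4) ^ ((3 : ℝ) / 2)))
          - κ * ((deriv (x i) t) ^ 2 + (deriv (y i) t) ^ 2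
              + κ * Bterm κ (x i t) (y i t) (deriv (x i) t) (deriv (y i) t)) * y i t) :
    ∃ h : ℝ, ∀ t ∈ Set.Ioo a b,
      (1 / 2) * (∑ i, m i * ((deriv (x i) t) ^ 2 + (deriv (y i) t) ^ 2
          + κ * Bterm κ (x i t) (y i t) (deriv (x i) t) (deriv (y i) t)))
        - (∑ i, ∑ j, if i < j then
            m i * m j * (1 - κ * rhoSq κ (x i t) (y i t) (x j t) (y j t) / 2)
              / (Real.sqrt (rhoSq κ (x i t) (y i t) (x j t) (y j t))
                * (1 - κ * rhoSq κ (x i t) (y i t) (x j t) (y j t) / 4) ^ ((1 : ℝ) / 2))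
            else 0)
        = h := by
  have hx' (i t) (ht : t ∈ Set.Ioo a b) : HasDerivAt (x i) (deriv (x i) t) t :=
    (hx i t ht).1.hasDerivAt
  have hy' (i t) (ht : t ∈ Set.Ioo a b) : HasDerivAt (y i) (deriv (y i) t) t :=
    (hy i t ht).1.hasDerivAt
  let P (i j : Fin 3) (t : ℝ) : ℝ :=
    attractionPower κ (x i t) (y i t) (deriv (x i) t) (deriv (y i) t) (x j t) (y j t)
  let G (i j : Fin 3) (t : ℝ) : ℝ :=
    √(rhoSq κ (x i t) (y i t) (x j t) (y j t)) ^ 3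
      * (1 - κ * rhoSq κ (x i t) (y i t) (x j t) (y j t) / 4) ^ ((3 : ℝ) / 2)
  have hG (i j t) : G i j t = G j i t := by
    simp only [G, rhoSq_comm κ (x i t)]
  have hK (i t) (ht : t ∈ Set.Ioo a b) :
      HasDerivAt (fun τ => m i * ((deriv (x i) τ) ^ 2 + (deriv (y i) τ) ^ 2
          + κ * Bterm κ (x i τ) (y i τ) (deriv (x i) τ) (deriv (y i) τ)))
        (m i * (2 * ∑ j ∈ Finset.univ.erase i, m j * P i j t / G i j t)) t := by
    refine ((hasDerivAt_kinetic (hx' i t ht) (hy' i t ht) (hx i t ht).2.hasDerivAt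
      (hy i t ht).2.hasDerivAt (hconstr i t ht) (heqx i t ht) (heqy i t ht)).const_mul
        (m i)).congr_deriv ?_
    congr 2
    simp only [Finset.sum_mul, Finset.mul_sum, Finset.sum_div, ← Finset.sum_add_distrib]
    refine Finset.sum_congr rfl fun j _ => ?_
    simp only [P, G]
    rw [← attraction_work (hconstr i t ht) (hconstr j t ht)]
    ring
  have hU (i j t) (hij : i ≠ j) (ht : t ∈ Set.Ioo a b) :
      HasDerivAt (fun τ => m i * m j * (1 - κ * rhoSq κ (x i τ) (y i τ) (x j τ) (y j τ) / 2)
          / (√(rhoSq κ (x i τ) (y i τ) (x j τ) (y j τ))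
            * (1 - κ * rhoSq κ (x i τ) (y i τ) (x j τ) (y j τ) / 4) ^ ((1 : ℝ) / 2)))
        (m i * m j * (P i j t + P j i t) / G i j t) t := by
    have hR := hasDerivAt_rhoSq (hx' i t ht) (hy' i t ht) (hx' j t ht) (hy' j t ht)
      (hconstr i t ht) (hconstr j t ht)
    have hpot := hasDerivAt_pairPotential (hρpos i j hij t ht).1 (hρpos i j hij t ht).2
    simp only [mul_div_assoc (m i * m j)]
    refine ((hpot.comp t hR).const_mul (m i * m j)).congr_deriv ?_
    simp only [P, G]
    ring
  have e₀ : (Finset.univ.erase 0 : Finset (Fin 3)) = {1, 2} := by decide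
  have e₁ : (Finset.univ.erase 1 : Finset (Fin 3)) = {0, 2} := by decide
  have e₂ : (Finset.univ.erase 2 : Finset (Fin 3)) = {0, 1} := by decide
  have hE (t) (ht : t ∈ Set.Ioo a b) := (((HasDerivAt.fun_sum fun i (_ : i ∈ Finset.univ) =>
    hK i t ht).const_mul (1 / 2)).fun_sub (((hU 0 1 t (by decide) ht).fun_add
      (hU 0 2 t (by decide) ht)).fun_add (hU 1 2 t (by decide) ht))).congr_deriv
        (g' := 0) (by
          simp only [Fin.sum_univ_three, e₀, e₁, e₂]
          rw [Finset.sum_pair (by decide), Finset.sum_pair (by decide),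
            Finset.sum_pair (by decide), hG 1 0, hG 2 0, hG 2 1]
          ring)
  obtain ⟨h, hh⟩ := isOpen_Ioo.exists_is_const_of_deriv_eq_zero isPreconnected_Ioo
    (fun t ht => (hE t ht).differentiableAt.differentiableWithinAt) (fun t ht => (hE t ht).deriv)
  refine ⟨h, fun t ht => ?_⟩
  rw [← hh t ht]
  congr 1
  simp [Fin.sum_univ_three]
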